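/- Let R be a commutative local ring with identity with unique maximal ideal M. Then every proper ideal of R is a weakly 1-absorbing prime ideal of R if and only if M³ = 0. -/

import Mathlib

/-- A proper ideal `I` of a commutative ring `R` is *weakly 1-absorbing prime* if for all
nonunit elements `a, b, c` with `0 ≠ a * b * c ∈ I`, either `a * b ∈ I` or `c ∈ I`. -/
def IsWeakly1AbsorbingPrime {R : Type*} [CommRing R] (I : Ideal R) : Prop :=
  I ≠ ⊤ ∧ ∀ a b c : R, ¬IsUnit a → ¬IsUnit b → ¬IsUnit c →
    a * b * c ≠ 0 → a * b * c ∈ I → a * b ∈ I ∨ c ∈ I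

/-- A proper ideal `I` of a commutative ring `R` is *1-absorbing prime* if for all
nonunit elements `a, b, c` with `a * b * c ∈ I`, either `a * b ∈ I` or `c ∈ I`. -/
def Is1AbsorbingPrime {R : Type*} [CommRing R] (I : Ideal R) : Prop :=
  I ≠ ⊤ ∧ ∀ a b c : R, ¬IsUnit a → ¬IsUnit b → ¬IsUnit c →
    a * b * c ∈ I → a * b ∈ I ∨ c ∈ I

/-- A proper ideal `P` of a commutative ring `R` is *weakly prime* if for all `a, b`
with `0 ≠ a * b ∈ P`, either `a ∈ P` or `b ∈ P`. -/
def IsWeaklyPrime {R : Type*} [CommRing R] (P : Ideal R) : Prop :=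
  P ≠ ⊤ ∧ ∀ a b : R, a * b ≠ 0 → a * b ∈ P → a ∈ P ∨ b ∈ P

/-- Let `R` be a local ring with maximal ideal `M`. Then every proper ideal of `R` is
weakly 1-absorbing prime iff `M³ = 0`. -/
theorem statement17 {R : Type*} [CommRing R] [IsLocalRing R] :
    (∀ I : Ideal R, I ≠ ⊤ → IsWeakly1AbsorbingPrime I) ↔
      (IsLocalRing.maximalIdeal R) ^ 3 = ⊥ := by
  constructor
  · intro h
    have key : ∀ a ∈ IsLocalRing.maximalIdeal R, ∀ b ∈ IsLocalRing.maximalIdeal R,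
        ∀ c ∈ IsLocalRing.maximalIdeal R, a * b * c = 0 := by
      intro a ha b hb c hc
      by_contra hne
      have hproper : Ideal.span {a * b * c} ≠ ⊤ := by
        intro htop
        exact (IsLocalRing.mem_maximalIdeal c).1 hc
          (isUnit_of_mul_isUnit_right (Ideal.span_singleton_eq_top.1 htop))
      rcases (h _ hproper).2 a b c ((IsLocalRing.mem_maximalIdeal a).1 ha)
          ((IsLocalRing.mem_maximalIdeal b).1 hb) ((IsLocalRing.mem_maximalIdeal c).1 hc) hne
          (Ideal.mem_span_singleton_self _) with hab | hc'
      · obtain ⟨r, hr⟩ := Ideal.mem_span_singleton'.1 hab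
        have hu : IsUnit (1 - r * c) :=
          IsLocalRing.isUnit_one_sub_self_of_mem_nonunits _
            ((IsLocalRing.maximalIdeal R).mul_mem_left r hc)
        have h0 : a * b * (1 - r * c) = 0 := by linear_combination -hr
        exact hne (by rw [hu.mul_left_eq_zero.1 h0, zero_mul])
      · obtain ⟨r, hr⟩ := Ideal.mem_span_singleton'.1 hc'
        have hu : IsUnit (1 - r * b * a) :=
          IsLocalRing.isUnit_one_sub_self_of_mem_nonunits _
            ((IsLocalRing.maximalIdeal R).mul_mem_left (r * b) ha)
        have h0 : c * (1 - r * b * a) = 0 := by linear_combination -hr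
        exact hne (by rw [hu.mul_left_eq_zero.1 h0, mul_zero])
    rw [eq_bot_iff, pow_succ, pow_two, Ideal.mul_le]
    intro x hx c hc
    rw [Ideal.mem_bot]
    induction hx using Submodule.mul_induction_on' with
    | mem_mul_mem a ha b hb => exact key a ha b hb c hc
    | add x _ y _ hx hy => rw [add_mul, hx, hy, add_zero]
  · intro hM I hI
    refine ⟨hI, fun a b c ha hb hc hne _ => absurd ?_ hne⟩
    rw [← Ideal.mem_bot, ← hM, pow_succ, pow_two]
    exact Ideal.mul_mem_mul (Ideal.mul_mem_mul ((IsLocalRing.mem_maximalIdeal a).2 ha)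
      ((IsLocalRing.mem_maximalIdeal b).2 hb)) ((IsLocalRing.mem_maximalIdeal c).2 hc)
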